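/- arXiv:0902.4542 — 4 statements merged into one kernel-verified Lean document; each statement's English description precedes it below -/
import Mathlib

section
/- Let G be a group with the unique root property which is generated by the union of two subgroups A and B. Let H be a subgroup of finite index in G and let φ be an automorphism of H such that φ ≠ id but φ restricts to the identity on H ∩ A and on H ∩ B. Then there is no automorphism ψ of G with ψ(h) = φ(h) for all h ∈ H. -/
/-- If `G` has the unique root property and is generated by subgroups `A` and `B`, and `φ` is a
nontrivial automorphism of a finite-index subgroup `H` restricting to the identity on `H ∩ A`
and `H ∩ B`, then `φ` does not extend to an automorphism of `G`. -/
theorem stmt_6 (G : Type*) [Group G]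
    (hurp : ∀ (x y : G) (n : ℕ), 0 < n → x ^ n = y ^ n → x = y)
    (A B : Subgroup G) (hgen : A ⊔ B = ⊤)
    (H : Subgroup G) (hH : H.FiniteIndex)
    (φ : H ≃* H) (hne : φ ≠ MulEquiv.refl H)
    (hfixA : ∀ (x : G) (hx : x ∈ H), x ∈ A → (φ ⟨x, hx⟩ : G) = x)
    (hfixB : ∀ (x : G) (hx : x ∈ H), x ∈ B → (φ ⟨x, hx⟩ : G) = x) :
    ¬∃ ψ : G ≃* G, ∀ (h : G) (hh : h ∈ H), ψ h = (φ ⟨h, hh⟩ : G) := by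
  rintro ⟨ψ, hψ⟩
  have hfix (C : Subgroup G)
      (hC : ∀ (x : G) (hx : x ∈ H), x ∈ C → (φ ⟨x, hx⟩ : G) = x) :
      C ≤ ψ.toMonoidHom.eqLocus (MonoidHom.id G) := by
    intro c hc
    obtain ⟨n, hn, -, hmem⟩ := Subgroup.exists_pow_mem_of_index_ne_zero hH.index_ne_zero c
    refine hurp _ _ n hn ?_
    change ψ c ^ n = c ^ n
    rw [← map_pow, hψ _ hmem, hC _ hmem (pow_mem hc n)]
  have htop : (⊤ : Subgroup G) ≤ ψ.toMonoidHom.eqLocus (MonoidHom.id G) :=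
    hgen ▸ sup_le (hfix A hfixA) (hfix B hfixB)
  refine hne (MulEquiv.ext fun h => Subtype.ext ?_)
  exact (hψ h h.2).symm.trans (htop (Subgroup.mem_top (h : G)))
end

section
/- Let G1 and G2 be groups, let φ1 : ℤ → G1 and φ2 : ℤ → G2 be injective group homomorphisms, and let G = G1 ∗_C G2 be the amalgamated free product (pushout of groups) of G1 and G2 along these maps, with canonical maps ι1 : G1 → G and ι2 : G2 → G; the amalgamated subgroup C is infinite cyclic. If G2 is abelian, assume moreover that G2 is the internal direct sum K ⊕ L of two subgroups with φ2(ℤ) ≤ K and |L| > 2. Then G admits an automorphism Φ with Φ ≠ id such that Φ(ι1(g)) = ι1(g) for every g ∈ G1. -/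
namespace AddCommGroup

/-- An abelian group with more than two elements has a nontrivial automorphism. -/
theorem exists_addEquiv_ne_refl {A : Type*} [AddCommGroup A] (hA : (2 : Cardinal) < Cardinal.mk A) :
    ∃ β : A ≃+ A, β ≠ AddEquiv.refl A := by
  by_cases h2 : ∀ a : A, 2 • a = 0
  · obtain ⟨x, hx⟩ := Cardinal.exists_notMem_of_length_lt [(0 : A)]
      (lt_trans (by simp) hA)
    obtain ⟨y, hy⟩ := Cardinal.exists_notMem_of_length_lt [(0 : A), x] (by simpa using hA)
    simp only [List.mem_cons, List.not_mem_nil, or_false, not_or] at hx hy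
    let : Module (ZMod 2) A := AddCommGroup.zmodModule h2
    have hyx : y ∉ Submodule.span (ZMod 2) {x} := by
      rw [Submodule.mem_span_singleton]
      rintro ⟨c, rfl⟩
      fin_cases c
      · exact hy.1 (zero_smul _ _)
      · exact hy.2 (one_smul _ _)
    obtain ⟨f, hf, hle⟩ := Submodule.exists_le_ker_of_notMem hyx
    have hfx : f x = 0 := hle (Submodule.mem_span_singleton_self x)
    refine ⟨(LinearEquiv.transvection hfx).toAddEquiv, fun h ↦ ?_⟩
    have := DFunLike.congr_fun h y
    simp [LinearMap.transvection.apply, hf, hx] at this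
  · refine ⟨AddEquiv.neg A, fun h ↦ h2 fun a ↦ ?_⟩
    have := DFunLike.congr_fun h a
    rw [two_nsmul]
    exact neg_eq_iff_add_eq_zero.mp this

end AddCommGroup

/-- If a commutative group is the internal direct product of `K` and `L` with `|L| > 2`, it has
a nontrivial automorphism fixing `K` pointwise. -/
theorem Subgroup.exists_mulEquiv_ne_refl_of_isCompl {G : Type*} [CommGroup G] {K L : Subgroup G}
    (hKL : IsCompl K L) (hL : (2 : Cardinal) < Cardinal.mk L) :
    ∃ α : G ≃* G, α ≠ MulEquiv.refl G ∧ ∀ k ∈ K, α k = k := by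
  obtain ⟨β, hβ⟩ := AddCommGroup.exists_addEquiv_ne_refl (A := Additive L) hL
  let γ : L ≃* L := MulEquiv.toAdditive.symm β
  obtain ⟨l, hl⟩ : ∃ l, γ l ≠ l := by
    by_contra! h
    exact hβ (DFunLike.ext _ _ h)
  let e : K × L ≃* G := MulEquiv.ofBijective (K.subtype.coprod L.subtype) <| by
    constructor
    · rw [injective_iff_map_eq_one]
      rintro ⟨k, l⟩ h
      simp only [MonoidHom.coprod_apply, Subgroup.subtype_apply] at h
      have hk := Subgroup.disjoint_iff_mul_eq_one.mp hKL.disjoint k.2 l.2 h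
      exact Prod.ext (Subtype.ext hk.1) (Subtype.ext hk.2)
    · intro g
      obtain ⟨k, hk, l, hl, rfl⟩ := Subgroup.mem_sup.mp (hKL.sup_eq_top ▸ Subgroup.mem_top g)
      exact ⟨(⟨k, hk⟩, ⟨l, hl⟩), rfl⟩
  let α : G ≃* G := (e.symm.trans ((MulEquiv.refl K).prodCongr γ)).trans e
  have hα (p : K × L) : α (e p) = e (p.1, γ p.2) := by
    simp [α, MulEquiv.prodCongr, Prod.map]
  refine ⟨α, fun h ↦ hl ?_, fun k hk ↦ ?_⟩
  · have := hα (1, l)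
    rw [h] at this
    exact (congr_arg Prod.snd (e.injective this)).symm
  · have he : e (⟨k, hk⟩, 1) = k :=
      mul_one k
    have := hα (⟨k, hk⟩, 1)
    rwa [map_one γ, he] at this

/-- In a noncommutative group, every element is fixed by some nontrivial automorphism. -/
theorem MulAut.exists_ne_refl_apply_eq {G : Type*} [Group G] (hG : ¬ ∀ a b : G, a * b = b * a)
    (c : G) : ∃ α : G ≃* G, α ≠ MulEquiv.refl G ∧ α c = c := by
  have key {g h : G} (hgh : g * h ≠ h * g) : MulAut.conj g ≠ MulEquiv.refl G := fun H ↦ hgh <| by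
    have := DFunLike.congr_fun H h
    rwa [MulAut.conj_apply, MulEquiv.refl_apply, mul_inv_eq_iff_eq_mul] at this
  push Not at hG
  obtain ⟨a, b, hab⟩ := hG
  by_cases hac : a * c = c * a
  · exact ⟨MulAut.conj a, key hab, by simp [hac]⟩
  · exact ⟨MulAut.conj c, key (Ne.symm hac), by simp⟩

namespace Monoid.PushoutI

variable {ι H : Type*} {G : ι → Type*} [∀ i, Group (G i)] [Group H] {φ : ∀ i, H →* G i}

/-- Automorphisms of the factors that fix the amalgamated subgroup pointwise induce an
endomorphism of the amalgamated product. -/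
def mapOfFixes (α : ∀ i, G i →* G i) (hα : ∀ i, (α i).comp (φ i) = φ i) :
    PushoutI φ →* PushoutI φ :=
  lift (fun i ↦ (of i).comp (α i)) (base φ) fun i ↦ by
    rw [MonoidHom.comp_assoc, hα, of_comp_eq_base]

@[simp]
theorem mapOfFixes_of (α : ∀ i, G i →* G i) (hα : ∀ i, (α i).comp (φ i) = φ i) (i : ι) (g : G i) :
    mapOfFixes α hα (of i g) = of i (α i g) := by
  simp [mapOfFixes]

@[simp]
theorem mapOfFixes_base (α : ∀ i, G i →* G i) (hα : ∀ i, (α i).comp (φ i) = φ i) (h : H) :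
    mapOfFixes α hα (base φ h) = base φ h := by
  simp [mapOfFixes]

/-- Automorphisms of the factors that fix the amalgamated subgroup pointwise induce an
automorphism of the amalgamated product. -/
def congrOfFixes (α : ∀ i, G i ≃* G i) (hα : ∀ i h, α i (φ i h) = φ i h) :
    PushoutI φ ≃* PushoutI φ :=
  MonoidHom.toMulEquiv
    (mapOfFixes (fun i ↦ (α i).toMonoidHom) fun i ↦ MonoidHom.ext (hα i))
    (mapOfFixes (fun i ↦ (α i).symm.toMonoidHom) fun i ↦ MonoidHom.ext fun h ↦
      (α i).symm_apply_eq.mpr (hα i h).symm)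
    (hom_ext (fun i ↦ by ext; simp) (by ext; simp))
    (hom_ext (fun i ↦ by ext; simp) (by ext; simp))

@[simp]
theorem congrOfFixes_of (α : ∀ i, G i ≃* G i) (hα : ∀ i h, α i (φ i h) = φ i h) (i : ι) (g : G i) :
    congrOfFixes α hα (of i g) = of i (α i g) :=
  mapOfFixes_of (fun i ↦ (α i).toMonoidHom) (fun i ↦ MonoidHom.ext (hα i)) i g

end Monoid.PushoutI


/-- Let `G = G1 ∗_C G2` be the amalgamated free product (pushout) of `G1 = K true` and
`G2 = K false` along injective homomorphisms `φ i : ℤ → K i` (so the amalgamated subgroup `C`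
is infinite cyclic). If `G2` is abelian, assume moreover that `G2 = K' ⊕ L'` with
`φ2(ℤ) ≤ K'` and `|L'| > 2`. Then `G` admits a nontrivial automorphism fixing `ι1(G1)`
pointwise. -/
theorem stmt_10 (K : Bool → Type*) [∀ i, Group (K i)]
    (φ : ∀ i, Multiplicative ℤ →* K i)
    (hinj : ∀ i, Function.Injective (φ i))
    (habel : (∀ a b : K false, a * b = b * a) →
      ∃ K' L' : Subgroup (K false),
        (∀ k ∈ K', ∀ l ∈ L', k * l = l * k) ∧
        K' ⊓ L' = ⊥ ∧ K' ⊔ L' = ⊤ ∧ (φ false).range ≤ K' ∧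
        (2 : Cardinal) < Cardinal.mk L') :
    ∃ Φ : Monoid.PushoutI φ ≃* Monoid.PushoutI φ,
      Φ ≠ MulEquiv.refl (Monoid.PushoutI φ) ∧
      ∀ g : K true, Φ (Monoid.PushoutI.of (φ := φ) true g) =
        Monoid.PushoutI.of (φ := φ) true g := by
  obtain ⟨α, hα, hfix⟩ : ∃ α : K false ≃* K false, α ≠ MulEquiv.refl (K false) ∧
      ∀ z, α (φ false z) = φ false z := by
    by_cases hcomm : ∀ a b : K false, a * b = b * a
    · obtain ⟨K', L', -, hinf, hsup, hle, hcard⟩ := habel hcomm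
      let : CommGroup (K false) := { ‹∀ i, Group (K i)› false with mul_comm := hcomm }
      obtain ⟨α, hα, hK⟩ := Subgroup.exists_mulEquiv_ne_refl_of_isCompl
        (IsCompl.of_eq hinf hsup) hcard
      exact ⟨α, hα, fun z ↦ hK _ (hle ⟨z, rfl⟩)⟩
    · obtain ⟨α, hα, hc⟩ := MulAut.exists_ne_refl_apply_eq hcomm (φ false (Multiplicative.ofAdd 1))
      have : α.toMonoidHom.comp (φ false) = φ false := MonoidHom.ext_mint hc
      exact ⟨α, hα, DFunLike.congr_fun this⟩
  let A : ∀ i, K i ≃* K i := fun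
    | true => MulEquiv.refl _
    | false => α
  have hA : ∀ i z, A i (φ i z) = φ i z := fun
    | true => fun _ ↦ rfl
    | false => hfix
  refine ⟨Monoid.PushoutI.congrOfFixes A hA, fun h ↦ hα ?_,
    Monoid.PushoutI.congrOfFixes_of A hA true⟩
  ext g
  have := DFunLike.congr_fun h (Monoid.PushoutI.of false g)
  rw [Monoid.PushoutI.congrOfFixes_of] at this
  exact Monoid.PushoutI.of_injective hinj false this
end

section
/- Let X be a type, x ∈ X, and let p ≥ 2 be an integer. Let F be the free group on X and let f : F → ℤ/pℤ be the homomorphism sending the generator x to 1 and every generator y ∈ X with y ≠ x to 0; let H = ker f, a normal subgroup of index p in F. Then H is a free group with free basis the family consisting of x^p together with the elements x^{-i} y x^{i} for y ∈ X, y ≠ x, and 0 ≤ i ≤ p − 1; in particular these elements are pairwise distinct and freely generate H. -/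
namespace FreeGroup

variable {X : Type*} (x : X) (n : ℕ)

/-- The elements `x ^ (n + 1)` and `x ^ (-i) * y * x ^ i`, for `y ≠ x` and `0 ≤ i ≤ n`. -/
def cyclicGenerator : Unit ⊕ ({y : X // y ≠ x} × Fin (n + 1)) → FreeGroup X
  | Sum.inl _ => of x ^ (n + 1)
  | Sum.inr (y, i) => of x ^ (-(i : ℤ)) * of (y : X) * of x ^ (i : ℤ)

/-- The free group on abstract generators indexing the elements `cyclicGenerator x n`. -/
abbrev CyclicCover := FreeGroup (Unit ⊕ ({y : X // y ≠ x} × Fin (n + 1)))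

variable [DecidableEq X]

/-- The permutation by which a generator of `FreeGroup X` acts on `Fin (n + 1) × CyclicCover x n`,
where `(i, g)` stands for the element `x ^ i * g`. -/
def cyclicPerm (y : X) : Equiv.Perm (Fin (n + 1) × CyclicCover x n) :=
  if h : y = x then
    Equiv.prodShear (finRotate (n + 1)) fun i =>
      if i = Fin.last n then Equiv.mulLeft (of (Sum.inl ())) else Equiv.refl _
  else
    Equiv.prodShear (Equiv.refl _) fun i => Equiv.mulLeft (of (Sum.inr (⟨y, h⟩, i)))

variable {x n}

lemma cyclicPerm_self_last (g : CyclicCover x n) :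
    cyclicPerm x n x (Fin.last n, g) = (0, of (Sum.inl ()) * g) := by
  simp [cyclicPerm]

lemma cyclicPerm_self_of_lt {k : ℕ} (hk : k < n) (g : CyclicCover x n) :
    cyclicPerm x n x (⟨k, by omega⟩, g) = (⟨k + 1, by omega⟩, g) := by
  have h : (⟨k, by omega⟩ : Fin (n + 1)) ≠ Fin.last n := by simp [Fin.ext_iff, hk.ne]
  simp [cyclicPerm, h, finRotate_of_lt hk]

lemma cyclicPerm_of_ne {y : X} (hy : y ≠ x) (i : Fin (n + 1)) (g : CyclicCover x n) :
    cyclicPerm x n y (i, g) = (i, of (Sum.inr (⟨y, hy⟩, i)) * g) := by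
  simp [cyclicPerm, hy]

lemma cyclicPerm_self_pow_zero {k : ℕ} (hk : k < n + 1) (g : CyclicCover x n) :
    (cyclicPerm x n x ^ k) (0, g) = (⟨k, hk⟩, g) := by
  induction k with
  | zero => rfl
  | succ k ih =>
    rw [pow_succ', Equiv.Perm.mul_apply, ih (by omega), cyclicPerm_self_of_lt (by omega)]

lemma lift_cyclicPerm_cyclicGenerator (a : Unit ⊕ ({y : X // y ≠ x} × Fin (n + 1)))
    (g : CyclicCover x n) :
    lift (cyclicPerm x n) (cyclicGenerator x n a) (0, g) = (0, of a * g) := by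
  rcases a with _ | ⟨y, i⟩
  · rw [cyclicGenerator, _root_.map_pow, lift_apply_of, pow_succ', Equiv.Perm.mul_apply,
      cyclicPerm_self_pow_zero (Nat.lt_succ_self n)]
    exact cyclicPerm_self_last g
  · rw [cyclicGenerator, _root_.map_mul, _root_.map_mul, _root_.map_zpow, _root_.map_zpow,
      lift_apply_of, lift_apply_of, zpow_neg, zpow_natCast, Equiv.Perm.mul_apply,
      Equiv.Perm.mul_apply, cyclicPerm_self_pow_zero i.isLt, cyclicPerm_of_ne y.2,
      Equiv.Perm.inv_eq_iff_eq, cyclicPerm_self_pow_zero i.isLt]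

lemma lift_cyclicPerm_lift_cyclicGenerator (w g : CyclicCover x n) :
    lift (cyclicPerm x n) (lift (cyclicGenerator x n) w) (0, g) = (0, w * g) := by
  induction w using FreeGroup.induction_on generalizing g with
  | C1 => simp
  | of a => simpa using lift_cyclicPerm_cyclicGenerator a g
  | inv_of a _ =>
    rw [_root_.map_inv, _root_.map_inv, Equiv.Perm.inv_eq_iff_eq, lift_apply_of,
      lift_cyclicPerm_cyclicGenerator, mul_inv_cancel_left]
  | mul u v hu hv => rw [_root_.map_mul, _root_.map_mul, Equiv.Perm.mul_apply, hv, hu, mul_assoc]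

lemma lift_cyclicGenerator_injective : Function.Injective (lift (cyclicGenerator x n)) := by
  intro u v huv
  have h := lift_cyclicPerm_lift_cyclicGenerator u 1
  rw [huv, lift_cyclicPerm_lift_cyclicGenerator] at h
  simpa using h.symm

variable (x n) in
/-- The element `x ^ i * g` represented by `(i, g)`. -/
def cyclicEval (s : Fin (n + 1) × CyclicCover x n) : FreeGroup X :=
  of x ^ (s.1 : ℕ) * lift (cyclicGenerator x n) s.2

lemma cyclicEval_cyclicPerm (y : X) (s : Fin (n + 1) × CyclicCover x n) :
    cyclicEval x n (cyclicPerm x n y s) = of y * cyclicEval x n s := by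
  obtain ⟨⟨k, hk⟩, g⟩ := s
  by_cases hy : y = x
  · subst hy
    obtain h | rfl := Nat.lt_succ_iff_lt_or_eq.mp hk
    · rw [cyclicPerm_self_of_lt h]
      simp [cyclicEval, pow_succ', mul_assoc]
    · refine (congrArg (cyclicEval y k) (cyclicPerm_self_last g)).trans ?_
      simp [cyclicEval, cyclicGenerator, pow_succ', mul_assoc]
  · rw [cyclicPerm_of_ne hy]
    simp [cyclicEval, cyclicGenerator, mul_assoc]

lemma cyclicEval_lift_cyclicPerm (w : FreeGroup X) (s : Fin (n + 1) × CyclicCover x n) :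
    cyclicEval x n (lift (cyclicPerm x n) w s) = w * cyclicEval x n s := by
  induction w using FreeGroup.induction_on generalizing s with
  | C1 => simp
  | of y => simpa using cyclicEval_cyclicPerm y s
  | inv_of y _ =>
    rw [eq_inv_mul_iff_mul_eq, ← cyclicEval_cyclicPerm, _root_.map_inv, lift_apply_of,
      Equiv.Perm.inv_def, Equiv.apply_symm_apply]
  | mul u v hu hv => rw [_root_.map_mul, Equiv.Perm.mul_apply, hu, hv, mul_assoc]

/-- Every element of the free group has the form `x ^ i * g`, with `0 ≤ i ≤ n` and `g` in the
subgroup generated by the `cyclicGenerator x n`. -/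
lemma cyclicEval_surjective : Function.Surjective (cyclicEval x n) := fun w =>
  ⟨lift (cyclicPerm x n) w (0, 1), (cyclicEval_lift_cyclicPerm w (0, 1)).trans (by simp [cyclicEval])⟩

lemma range_lift_cyclicGenerator {f : FreeGroup X →* Multiplicative (ZMod (n + 1))}
    (hf : f = lift fun y => if y = x then Multiplicative.ofAdd (1 : ZMod (n + 1)) else 1) :
    (lift (cyclicGenerator x n)).range = f.ker := by
  have hx (k : ℕ) : f (of x ^ k) = Multiplicative.ofAdd (k : ZMod (n + 1)) := by
    simp [hf, ← ofAdd_nsmul]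
  have hle : (lift (cyclicGenerator x n)).range ≤ f.ker := by
    apply range_lift_le
    rintro _ ⟨_ | ⟨y, i⟩, rfl⟩
    · exact (hx (n + 1)).trans (by rw [ZMod.natCast_self, ofAdd_zero])
    · simp [cyclicGenerator, MonoidHom.mem_ker, hf, y.2]
  refine le_antisymm hle fun w hw => ?_
  obtain ⟨⟨i, g⟩, rfl⟩ := cyclicEval_surjective (x := x) (n := n) w
  have hg : f (lift (cyclicGenerator x n) g) = 1 := hle ⟨g, rfl⟩
  rw [MonoidHom.mem_ker, cyclicEval, _root_.map_mul, hg, mul_one, hx, ofAdd_eq_one,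
    ZMod.natCast_eq_zero_iff] at hw
  have hi : (i : ℕ) = 0 := Nat.eq_zero_of_dvd_of_lt hw i.isLt
  exact ⟨g, by rw [cyclicEval, hi, pow_zero, one_mul]⟩

end FreeGroup

/-- Let `F` be the free group on `X`, `x ∈ X`, `p ≥ 2`, and `f : F → ℤ/pℤ` the homomorphism
sending `x` to `1` and all other generators to `0`. Then `H = ker f` has index `p` in `F` and
is free with free basis consisting of `x^p` together with `x^(-i) y x^i` for `y ≠ x` and
`0 ≤ i ≤ p - 1`. -/
theorem stmt_11 (X : Type*) [DecidableEq X] (x : X) (p : ℕ) (hp : 2 ≤ p)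
    (f : FreeGroup X →* Multiplicative (ZMod p))
    (hf : f = FreeGroup.lift fun y =>
      if y = x then Multiplicative.ofAdd (1 : ZMod p) else 1) :
    f.ker.index = p ∧
    ∃ b : FreeGroupBasis (Unit ⊕ ({y : X // y ≠ x} × Fin p)) f.ker,
      ((b (Sum.inl ()) : FreeGroup X) = FreeGroup.of x ^ p) ∧
      ∀ (y : {y : X // y ≠ x}) (i : Fin p),
        (b (Sum.inr (y, i)) : FreeGroup X) =
          FreeGroup.of x ^ (-(i : ℤ)) * FreeGroup.of (y : X) * FreeGroup.of x ^ (i : ℤ) := by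
  obtain ⟨n, rfl⟩ : ∃ n, p = n + 1 := ⟨p - 1, by omega⟩
  have hsurj : Function.Surjective f := fun a =>
    ⟨FreeGroup.of x ^ (Multiplicative.toAdd a).val, by simp [hf, ← ofAdd_nsmul]⟩
  refine ⟨?_, FreeGroupBasis.ofRepr
    ((MonoidHom.ofInjective FreeGroup.lift_cyclicGenerator_injective).trans
      (MulEquiv.subgroupCongr (FreeGroup.range_lift_cyclicGenerator hf))).symm, ?_, fun y i => ?_⟩
  · rw [Subgroup.index_ker, MonoidHom.range_eq_top.mpr hsurj, Subgroup.card_top,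
      Nat.card_congr Multiplicative.toAdd, Nat.card_zmod]
  · exact FreeGroup.lift_apply_of
  · exact FreeGroup.lift_apply_of
end

section
/- Let G be the amalgamated product defined in the context. Then G has the unique root property: for all x, y ∈ G and every positive integer n, x^n = y^n implies x = y. In particular, G is torsion-free. -/
/-- A group is Obraztsov if it is 2-generated, simple, complete (trivial center and all
automorphisms inner), torsion-free, and every nontrivial proper subgroup is infinite cyclic. -/
def IsObraztsov (G : Type*) [Group G] : Prop :=
  (∃ a b : G, Subgroup.closure {a, b} = ⊤) ∧
  IsSimpleGroup G ∧
  Subgroup.center G = ⊥ ∧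
  (∀ φ : G ≃* G, ∃ g : G, ∀ y : G, φ y = g * y * g⁻¹) ∧
  (∀ g : G, g ≠ 1 → ¬IsOfFinOrder g) ∧
  (∀ K : Subgroup G, K ≠ ⊥ → K ≠ ⊤ → IsCyclic K ∧ Infinite K)

/-- `h` generates a maximal cyclic subgroup. -/
def IsMaxCyclicGen {H : Type*} [Group H] (h : H) : Prop :=
  ∀ w : H, Subgroup.zpowers h ≤ Subgroup.zpowers w →
    Subgroup.zpowers h = Subgroup.zpowers w

/-- `u i = (h i, 1) ∈ H i × ℤ`. -/
def amalgU {H : Bool → Type*} [∀ i, Group (H i)] (h : ∀ i, H i) (i : Bool) :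
    H i × Multiplicative ℤ :=
  (h i, Multiplicative.ofAdd (1 : ℤ))

/-- The homomorphism `ℤ → H i × ℤ` sending `1 ↦ u i`. -/
def amalgMap {H : Bool → Type*} [∀ i, Group (H i)] (h : ∀ i, H i) (i : Bool) :
    Multiplicative ℤ →* H i × Multiplicative ℤ :=
  zpowersHom _ (amalgU h i)

/-- The amalgamated free product `G = (H₁ × ℤ) ∗_{u₁ = u₂} (H₂ × ℤ)`. -/
abbrev Amalg (H : Bool → Type*) [∀ i, Group (H i)] (h : ∀ i, H i) : Type _ :=
  Monoid.PushoutI (amalgMap h)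


open Monoid

namespace Monoid.CoprodI

variable {H : Bool → Type*} [∀ i, Group (H i)]

/-- `HasForm f i j m`: the normal form of `f` has `m ≥ 1` letters, the first one in `H i` and
the last one in `H j`. -/
def HasForm (f : CoprodI H) (i j : Bool) (m : ℕ) : Prop :=
  ∃ w : NeWord H i j, w.prod = f ∧ w.toList.length = m

theorem word_prod_injective : Function.Injective (Word.prod : Word H → CoprodI H) := by
  classical
  exact Word.equiv.symm.injective

theorem neWord_toList_eq {i j k l : Bool} {v : NeWord H i j} {w : NeWord H k l}
    (h : v.prod = w.prod) : v.toList = w.toList :=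
  congrArg Word.toList (word_prod_injective h)

theorem neWord_prod_eq {i j k l : Bool} {v : NeWord H i j} {w : NeWord H k l}
    (h : v.toList = w.toList) : v.prod = w.prod := by
  have : v.toWord = w.toWord := Word.ext h
  simp only [NeWord.prod, this]

theorem eq_one_or_hasForm (f : CoprodI H) : f = 1 ∨ ∃ i j m, HasForm f i j m := by
  classical
  obtain ⟨w, rfl⟩ := Word.equiv.symm.surjective f
  by_cases hw : w = Word.empty
  · left
    subst hw
    exact Word.prod_empty
  · obtain ⟨i, j, v, rfl⟩ := NeWord.of_word w hw
    exact Or.inr ⟨i, j, _, v, rfl, rfl⟩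

namespace HasForm

theorem of_ne_one {i : Bool} {g : H i} (hg : g ≠ 1) : HasForm (of g) i i 1 :=
  ⟨.singleton g hg, NeWord.prod_singleton g hg, rfl⟩

theorem mul {f f' : CoprodI H} {i j k l : Bool} {m m' : ℕ} (hf : HasForm f i j m)
    (hf' : HasForm f' k l m') (hjk : j ≠ k) : HasForm (f * f') i l (m + m') := by
  obtain ⟨v, rfl, rfl⟩ := hf
  obtain ⟨w, rfl, rfl⟩ := hf'
  exact ⟨.append v hjk w, NeWord.append_prod, List.length_append⟩

theorem not_one {i j : Bool} {m : ℕ} : ¬ HasForm (1 : CoprodI H) i j m := by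
  rintro ⟨w, hw, -⟩
  rw [← Word.prod_empty] at hw
  exact w.toList_ne_nil (congrArg Word.toList (word_prod_injective hw))

theorem unique {f : CoprodI H} {i j k l : Bool} {m m' : ℕ} (hf : HasForm f i j m)
    (hf' : HasForm f k l m') : i = k ∧ j = l ∧ m = m' := by
  obtain ⟨v, rfl, rfl⟩ := hf
  obtain ⟨w, hw, rfl⟩ := hf'
  have h := neWord_toList_eq hw
  have h1 := v.toList_head?
  have h2 := v.toList_getLast?
  rw [← h, NeWord.toList_head?] at h1
  rw [← h, NeWord.toList_getLast?] at h2
  simp only [Option.some.injEq, Sigma.mk.injEq] at h1 h2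
  exact ⟨h1.1.symm, h2.1.symm, by rw [h]⟩

theorem left_cancel {a b p q : CoprodI H} {i j k l i' j' k' l' : Bool} {m r r' : ℕ}
    (ha : HasForm a i j m) (hb : HasForm b i' j' m) (hp : HasForm p k l r)
    (hq : HasForm q k' l' r') (hjk : j ≠ k) (hjk' : j' ≠ k') (h : a * p = b * q) : a = b := by
  obtain ⟨v, rfl, hv⟩ := ha
  obtain ⟨w, rfl, hw⟩ := hb
  obtain ⟨v', rfl, -⟩ := hp
  obtain ⟨w', rfl, -⟩ := hq
  rw [← NeWord.append_prod (hne := hjk), ← NeWord.append_prod (hne := hjk')] at h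
  exact neWord_prod_eq (List.append_inj_left (neWord_toList_eq h) (hv.trans hw.symm))

theorem cases_left {f : CoprodI H} {i j : Bool} {m : ℕ} (hf : HasForm f i j m) :
    (i = j ∧ m = 1 ∧ ∃ s : H i, s ≠ 1 ∧ f = of s) ∨
      ∃ (s : H i) (f' : CoprodI H) (m' : ℕ),
        s ≠ 1 ∧ HasForm f' (!i) j m' ∧ f = of s * f' ∧ m = m' + 1 := by
  obtain ⟨w, rfl, rfl⟩ := hf
  induction w with
  | singleton x hx => exact Or.inl ⟨rfl, rfl, x, hx, NeWord.prod_singleton x hx⟩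
  | @append i j k l v hne w ihv ihw =>
    right
    rw [NeWord.append_prod]
    have hw : HasForm w.prod k l w.toList.length := ⟨w, rfl, rfl⟩
    rcases ihv with ⟨rfl, hm, s, hs, hv⟩ | ⟨s, f', m', hs, hf', hv, hm⟩
    · obtain rfl : k = !i := by cases i <;> cases k <;> simp_all
      exact ⟨s, _, _, hs, hw, by rw [hv], by simp [hm, add_comm]⟩
    · exact ⟨s, _, _, hs, hf'.mul hw hne, by rw [hv, mul_assoc],
        by simp only [NeWord.toList, List.length_append, hm]; omega⟩

theorem inv {f : CoprodI H} {i j : Bool} {m : ℕ} (hf : HasForm f i j m) :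
    HasForm f⁻¹ j i m := by
  obtain ⟨w, rfl, rfl⟩ := hf
  refine ⟨w.inv, NeWord.inv_prod w, ?_⟩
  induction w with
  | singleton x hx => rfl
  | append v hne w ihv ihw => simp [NeWord.inv, ihv, ihw, add_comm]

theorem cases_right {f : CoprodI H} {i j : Bool} {m : ℕ} (hf : HasForm f i j m) :
    (i = j ∧ m = 1 ∧ ∃ s : H j, s ≠ 1 ∧ f = of s) ∨
      ∃ (s : H j) (f' : CoprodI H) (m' : ℕ),
        s ≠ 1 ∧ HasForm f' i (!j) m' ∧ f = f' * of s ∧ m = m' + 1 := by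
  rcases hf.inv.cases_left with ⟨hij, hm, s, hs, h⟩ | ⟨s, f', m', hs, hf', h, hm⟩
  · exact Or.inl ⟨hij.symm, hm, s⁻¹, inv_ne_one.2 hs, by rw [map_inv, ← h, inv_inv]⟩
  · exact Or.inr ⟨s⁻¹, f'⁻¹, m', inv_ne_one.2 hs, hf'.inv,
      by rw [map_inv, ← mul_inv_rev, ← h, inv_inv], hm⟩

/-- An element whose normal form starts and ends in the same factor is a letter, or it is a
shorter element of the same kind enclosed by two letters. -/
theorem cases_diag {f : CoprodI H} {i : Bool} {m : ℕ} (hf : HasForm f i i m) :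
    (m = 1 ∧ ∃ s : H i, s ≠ 1 ∧ f = of s) ∨
      ∃ (s t : H i) (f' : CoprodI H) (m' : ℕ), s ≠ 1 ∧ t ≠ 1 ∧ HasForm f' (!i) (!i) m' ∧
        f = of s * f' * of t ∧ m = m' + 2 := by
  rcases hf.cases_left with ⟨-, hm, h⟩ | ⟨s, f', m', hs, hf', rfl, rfl⟩
  · exact Or.inl ⟨hm, h⟩
  · rcases hf'.cases_right with ⟨h, -⟩ | ⟨t, f'', m'', ht, hf'', rfl, rfl⟩
    · simp at h
    · exact Or.inr ⟨s, t, f'', m'', hs, ht, hf'', (mul_assoc _ _ _).symm, rfl⟩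

theorem pos {f : CoprodI H} {i j : Bool} {m : ℕ} (hf : HasForm f i j m) : 0 < m := by
  obtain ⟨w, -, rfl⟩ := hf
  exact List.length_pos_of_ne_nil w.toList_ne_nil

theorem map {σ : MulAut (CoprodI H)} {τ : ∀ i, MulAut (H i)}
    (hσ : ∀ i (g : H i), σ (of g) = of (τ i g)) {f : CoprodI H} {i j : Bool} {m : ℕ}
    (hf : HasForm f i j m) : HasForm (σ f) i j m := by
  obtain ⟨w, rfl, rfl⟩ := hf
  induction w with
  | singleton x hx =>
    rw [NeWord.prod_singleton, hσ]
    exact of_ne_one (by simpa using hx)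
  | append v hne w ihv ihw =>
    rw [NeWord.append_prod, map_mul]
    simpa using ihv.mul ihw hne

end HasForm

end Monoid.CoprodI

/-- The twisted power `a * σ a * ⋯ * σ ^ (n - 1) a`. -/
def twistedPow {K : Type*} [Group K] (σ : MulAut K) (a : K) : ℕ → K
  | 0 => 1
  | n + 1 => a * σ (twistedPow σ a n)

section twistedPow

variable {K : Type*} [Group K] (σ : MulAut K)

theorem twistedPow_one (a : K) : twistedPow σ a 1 = a := by simp [twistedPow]

theorem twistedPow_succ (a : K) (n : ℕ) :
    twistedPow σ a (n + 1) = a * σ (twistedPow σ a n) := rfl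

theorem twistedPow_succ' (a : K) (n : ℕ) :
    twistedPow σ a (n + 1) = twistedPow σ a n * (σ ^ n) a := by
  induction n with
  | zero => simp [twistedPow]
  | succ n ih =>
    rw [twistedPow_succ, ih, map_mul, ← mul_assoc, ← twistedPow_succ, ih, pow_succ',
      MulAut.mul_apply]

theorem twistedPow_one_base (n : ℕ) : twistedPow σ 1 n = 1 := by
  induction n with
  | zero => rfl
  | succ n ih => simp [twistedPow, ih]

theorem twistedPow_conj (a s : K) (n : ℕ) :
    twistedPow σ (s * a * (σ s)⁻¹) n = s * twistedPow σ a n * ((σ ^ n) s)⁻¹ := by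
  induction n with
  | zero => simp [twistedPow]
  | succ n ih =>
    rw [twistedPow_succ, ih, twistedPow_succ, pow_succ', MulAut.mul_apply]
    simp [mul_assoc]

theorem map_twistedPow {L : Type*} [Group L] (ρ : MulAut L) (f : L →* K)
    (hf : ∀ g, σ (f g) = f (ρ g)) (a : L) (n : ℕ) :
    twistedPow σ (f a) n = f (twistedPow ρ a n) := by
  induction n with
  | zero => simp [twistedPow]
  | succ n ih => simp [twistedPow_succ, ih, hf]

theorem twistedPow_conjAut (g a : K) (n : ℕ) :
    twistedPow (MulAut.conj g) a n = (a * g) ^ n * (g ^ n)⁻¹ := by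
  induction n with
  | zero => simp [twistedPow]
  | succ n ih =>
    rw [twistedPow_succ, ih, MulAut.conj_apply, pow_succ' (a * g), pow_succ g, mul_inv_rev]
    group

end twistedPow

namespace Monoid.CoprodI

variable {H : Bool → Type*} [∀ i, Group (H i)] {σ : MulAut (CoprodI H)} {τ : ∀ i, MulAut (H i)}

theorem pow_apply_of (hσ : ∀ i (g : H i), σ (of g) = of (τ i g)) (n : ℕ) (i : Bool) (g : H i) :
    (σ ^ n) (of g) = of ((τ i ^ n) g) := by
  induction n with
  | zero => simp
  | succ n ih => rw [pow_succ', pow_succ', MulAut.mul_apply, MulAut.mul_apply, ih, hσ]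

namespace HasForm

theorem map_pow (hσ : ∀ i (g : H i), σ (of g) = of (τ i g)) (n : ℕ) {f : CoprodI H}
    {i j : Bool} {m : ℕ} (hf : HasForm f i j m) : HasForm ((σ ^ n) f) i j m :=
  hf.map (τ := fun i => τ i ^ n) (pow_apply_of hσ n)

theorem twistedPow_of_ne (hσ : ∀ i (g : H i), σ (of g) = of (τ i g)) {b : CoprodI H}
    {i j : Bool} {m : ℕ} (hb : HasForm b i j m) (hij : i ≠ j) (n : ℕ) :
    HasForm (twistedPow σ b (n + 1)) i j ((n + 1) * m) := by
  induction n with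
  | zero => simpa [twistedPow_one] using hb
  | succ n ih =>
    rw [twistedPow_succ]
    have := hb.mul (ih.map hσ) hij.symm
    rwa [show (n + 1 + 1) * m = m + (n + 1) * m by ring]

theorem not_mul {i j : Bool} {m : ℕ} {c : CoprodI H} (hc : HasForm c (!i) j m) {e : H i}
    (he : e ≠ 1) : HasForm (of e * c) i j (m + 1) := by
  rw [add_comm]
  exact (of_ne_one he).mul hc (by simp)

theorem mul_not {i j : Bool} {m : ℕ} {c : CoprodI H} (hc : HasForm c j (!i) m) {e : H i}
    (he : e ≠ 1) : HasForm (c * of e) j i (m + 1) :=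
  hc.mul (of_ne_one he) (by simp)

/-- Twisted powers preserve the first and the last factor of the normal form, and whether the
normal form is a single letter. -/
theorem twistedPow_of_eq (hσ : ∀ i (g : H i), σ (of g) = of (τ i g))
    (hτ : ∀ i (n : ℕ), Function.Injective fun a : H i => twistedPow (τ i) a (n + 1)) (n m : ℕ) :
    ∀ (b : CoprodI H) (i : Bool), HasForm b i i m →
      ∃ m', HasForm (twistedPow σ b (n + 1)) i i m' ∧ (m' = 1 ↔ m = 1) := by
  induction m using Nat.strong_induction_on with
  | _ m ih =>
  intro b i hb
  rcases hb.cases_diag with ⟨rfl, s, hs, rfl⟩ | ⟨s, t, c, m', hs, ht, hc, rfl, rfl⟩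
  · refine ⟨1, ?_, Iff.rfl⟩
    rw [map_twistedPow σ (τ i) of (hσ i)]
    refine of_ne_one fun h => hs (hτ i n ?_)
    simpa only [twistedPow_one_base] using h
  · have hb' : of s * c * of t = of s * (c * of (t * τ i s)) * (σ (of s))⁻¹ := by
      rw [hσ, map_mul]; group
    have hτs : ∀ k, (τ i ^ k) s ≠ 1 := fun k => by simpa using hs
    by_cases he : t * τ i s = 1
    · obtain ⟨m'', h, -⟩ := ih m' (by omega) c (!i) hc
      refine ⟨m'' + 2, ?_, by omega⟩
      rw [hb', twistedPow_conj, he, map_one, mul_one, pow_apply_of hσ, ← map_inv]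
      exact (h.not_mul hs).mul_not (inv_ne_one.2 (hτs _))
    · rcases n with _ | n
      · exact ⟨_, by rwa [twistedPow_one], Iff.rfl⟩
      · have hce := (hc.mul_not he).twistedPow_of_ne hσ (by simp) n
        have hct := (hc.mul_not ht).map_pow hσ (n + 1)
        have key : twistedPow σ (of s * c * of t) (n + 1 + 1) =
            of s * twistedPow σ (c * of (t * τ i s)) (n + 1) * (σ ^ (n + 1)) (c * of t) := by
          rw [twistedPow_succ', hb', twistedPow_conj, ← hb', mul_assoc (of s) c, map_mul _ (of s)]
          group
        rw [key]
        have hpos := hct.pos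
        exact ⟨_, (hce.not_mul hs).mul hct (by simp), by omega⟩

theorem twistedPow (hσ : ∀ i (g : H i), σ (of g) = of (τ i g))
    (hτ : ∀ i (n : ℕ), Function.Injective fun a : H i => twistedPow (τ i) a (n + 1)) (n : ℕ)
    {b : CoprodI H} {i j : Bool} {m : ℕ} (hb : HasForm b i j m) :
    ∃ m', HasForm (twistedPow σ b (n + 1)) i j m' ∧ (i = j → (m' = 1 ↔ m = 1)) ∧
      (i ≠ j → m' = (n + 1) * m) := by
  by_cases hij : i = j
  · subst hij
    obtain ⟨m', h, h1⟩ := twistedPow_of_eq hσ hτ n m b i hb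
    exact ⟨m', h, fun _ => h1, fun h => absurd rfl h⟩
  · exact ⟨_, hb.twistedPow_of_ne hσ hij n, fun h => absurd h hij, fun _ => rfl⟩

end HasForm

/-- If twisted powers are injective in both factors of a free product, then they are injective
in the free product. -/
theorem twistedPow_injective (hσ : ∀ i (g : H i), σ (of g) = of (τ i g))
    (hτ : ∀ i (n : ℕ), Function.Injective fun a : H i => twistedPow (τ i) a (n + 1)) (n : ℕ) :
    Function.Injective fun a : CoprodI H => twistedPow σ a (n + 1) := by
  have one_of : ∀ a : CoprodI H, twistedPow σ a (n + 1) = 1 → a = 1 := by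
    intro a ha
    rcases eq_one_or_hasForm a with h | ⟨i, j, m, h⟩
    · exact h
    · obtain ⟨m', h', -⟩ := h.twistedPow hσ hτ n
      rw [ha] at h'
      exact absurd h' HasForm.not_one
  have main : ∀ (m : ℕ) (a b : CoprodI H) (i j : Bool), HasForm a i j m →
      twistedPow σ a (n + 1) = twistedPow σ b (n + 1) → a = b := by
    intro m
    induction m using Nat.strong_induction_on with
    | _ m ih =>
    intro a b i j ha hab
    rcases eq_one_or_hasForm b with rfl | ⟨i', j', r, hb⟩
    · exact one_of a (by rw [hab, twistedPow_one_base])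
    obtain ⟨m', hm', hm1, hm2⟩ := ha.twistedPow hσ hτ n
    obtain ⟨r', hr', hr1, hr2⟩ := hb.twistedPow hσ hτ n
    rw [← hab] at hr'
    obtain ⟨rfl, rfl, rfl⟩ := hm'.unique hr'
    by_cases hij : i = j
    · subst hij
      have hmr : m = 1 ↔ r = 1 := (hm1 rfl).symm.trans (hr1 rfl)
      rcases ha.cases_diag with ⟨rfl, s, hs, rfl⟩ | ⟨s, t, c, k, hs, ht, hc, rfl, rfl⟩
      · obtain rfl : r = 1 := hmr.1 rfl
        rcases hb.cases_diag with ⟨-, s', hs', rfl⟩ | ⟨_, _, _, _, _, _, _, _, h⟩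
        · rw [map_twistedPow σ (τ i) of (hσ i), map_twistedPow σ (τ i) of (hσ i)] at hab
          rw [hτ i n (of_injective i hab)]
        · omega
      · have hconj : ∀ f : CoprodI H, twistedPow σ ((of s)⁻¹ * f * σ (of s)) (n + 1) =
            (of s)⁻¹ * twistedPow σ f (n + 1) * (σ ^ (n + 1)) (of s) := fun f => by
          simpa using twistedPow_conj σ f (of s)⁻¹ (n + 1)
        have ha' : (of s)⁻¹ * (of s * c * of t) * σ (of s) = c * of (t * τ i s) := by
          rw [hσ, map_mul]; group
        have heq : twistedPow σ ((of s)⁻¹ * (of s * c * of t) * σ (of s)) (n + 1) =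
            twistedPow σ ((of s)⁻¹ * b * σ (of s)) (n + 1) := by
          rw [hconj, hconj, hab]
        suffices (of s)⁻¹ * (of s * c * of t) * σ (of s) = (of s)⁻¹ * b * σ (of s) from
          mul_left_cancel (mul_right_cancel this)
        by_cases he : t * τ i s = 1
        · refine ih k (by omega) _ _ (!i) (!i) ?_ heq
          rwa [ha', he, map_one, mul_one]
        · refine ih (k + 1) (by omega) _ _ (!i) i ?_ heq
          rw [ha']
          exact hc.mul_not he
    · obtain rfl : m = r :=
        Nat.eq_of_mul_eq_mul_left n.succ_pos ((hm2 hij).symm.trans (hr2 hij))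
      rcases n with _ | n
      · simpa only [zero_add, twistedPow_one] using hab
      · have hp := (ha.twistedPow_of_ne hσ hij n).map hσ
        have hq := (hb.twistedPow_of_ne hσ hij n).map hσ
        rw [twistedPow_succ, twistedPow_succ σ b] at hab
        exact ha.left_cancel hb hp hq (Ne.symm hij) (Ne.symm hij) hab
  intro a b hab
  rcases eq_one_or_hasForm a with rfl | ⟨i, j, m, h⟩
  · exact (one_of b (by simpa only [twistedPow_one_base] using hab.symm)).symm
  · exact main m a b i j h hab

/-- The automorphism of a free product that conjugates each factor by one of its elements. -/
def conjFactors (h : ∀ i, H i) : MulAut (CoprodI H) where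
  toFun := lift fun i => of.comp (MulAut.conj (h i)).toMonoidHom
  invFun := lift fun i => of.comp (MulAut.conj (h i)⁻¹).toMonoidHom
  left_inv := by
    refine DFunLike.congr_fun (f := (lift fun i => of.comp (MulAut.conj (h i)⁻¹).toMonoidHom).comp
      (lift fun i => of.comp (MulAut.conj (h i)).toMonoidHom)) (g := MonoidHom.id (CoprodI H)) ?_
    ext i g
    simp [mul_assoc]
  right_inv := by
    refine DFunLike.congr_fun (f := (lift fun i => of.comp (MulAut.conj (h i)).toMonoidHom).comp
      (lift fun i => of.comp (MulAut.conj (h i)⁻¹).toMonoidHom)) (g := MonoidHom.id (CoprodI H)) ?_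
    ext i g
    simp [mul_assoc]
  map_mul' := map_mul _

@[simp]
theorem conjFactors_of (h : ∀ i, H i) {i : Bool} (g : H i) :
    conjFactors h (of g) = of (h i * g * (h i)⁻¹) := by
  simp [conjFactors]

@[simp]
theorem conjFactors_inv_of (h : ∀ i, H i) {i : Bool} (g : H i) :
    (conjFactors h)⁻¹ (of g) = of ((h i)⁻¹ * g * h i) := by
  rw [MulAut.inv_apply, MulEquiv.symm_apply_eq, conjFactors_of]
  group

theorem conjFactors_zpow_of (h : ∀ i, H i) (k : ℤ) {i : Bool} (g : H i) :
    (conjFactors h ^ k) (of g) = of (MulAut.conj (h i ^ k) g) := by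
  induction k using Int.induction_on with
  | zero => simp
  | succ k ih =>
    rw [add_comm, zpow_add, zpow_add, MulAut.mul_apply, ih]
    simp [mul_assoc]
  | pred k ih =>
    rw [sub_eq_neg_add, zpow_add, zpow_add, MulAut.mul_apply, ih, zpow_neg_one, conjFactors_inv_of]
    simp [mul_assoc]

end Monoid.CoprodI

namespace SemidirectProduct

theorem pow_left_eq_twistedPow {N G : Type*} [Group N] [Group G] {φ : G →* MulAut N}
    (x : N ⋊[φ] G) (n : ℕ) : (x ^ n).left = twistedPow (φ x.right) x.left n := by
  induction n with
  | zero => rfl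
  | succ n ih => rw [pow_succ', mul_left, ih, twistedPow_succ]

theorem pow_right_eq {N G : Type*} [Group N] [Group G] {φ : G →* MulAut N}
    (x : N ⋊[φ] G) (n : ℕ) : (x ^ n).right = x.right ^ n :=
  map_pow rightHom x n

end SemidirectProduct

/-- The semidirect product of `H₁ ∗ H₂` with `ℤ` acting as conjugation by `h i` on `H i`. -/
abbrev TwistedProduct {H : Bool → Type*} [∀ i, Group (H i)] (h : ∀ i, H i) : Type _ :=
  CoprodI H ⋊[zpowersHom (MulAut (CoprodI H)) (CoprodI.conjFactors h)] Multiplicative ℤ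

theorem TwistedProduct.isMulTorsionFree {H : Bool → Type*} [∀ i, Group (H i)]
    [∀ i, IsMulTorsionFree (H i)] (h : ∀ i, H i) : IsMulTorsionFree (TwistedProduct h) where
  pow_left_injective n hn x y hxy := by
    obtain ⟨n, rfl⟩ := Nat.exists_eq_succ_of_ne_zero hn
    simp only [Nat.succ_eq_add_one] at hxy
    have hr : x.right = y.right := by
      have := congrArg SemidirectProduct.right hxy
      rw [SemidirectProduct.pow_right_eq, SemidirectProduct.pow_right_eq] at this
      exact pow_left_injective n.succ_ne_zero this
    refine SemidirectProduct.ext ?_ hr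
    have hl := congrArg SemidirectProduct.left hxy
    rw [SemidirectProduct.pow_left_eq_twistedPow, SemidirectProduct.pow_left_eq_twistedPow,
      ← hr] at hl
    refine CoprodI.twistedPow_injective (τ := fun i => MulAut.conj (h i ^ x.right.toAdd))
      (fun i g => ?_) (fun i n a b hab => ?_) n hl
    · rw [zpowersHom_apply, CoprodI.conjFactors_zpow_of]
    · simp only [twistedPow_conjAut] at hab
      exact mul_right_cancel (pow_left_injective n.succ_ne_zero (mul_right_cancel hab))

/-- The embedding of the factor `H i × ℤ` of the amalgam in the semidirect product. -/
def twistedFactor {H : Bool → Type*} [∀ i, Group (H i)] (h : ∀ i, H i) (i : Bool) :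
    H i × Multiplicative ℤ →* TwistedProduct h :=
  MonoidHom.noncommCoprod (SemidirectProduct.inl.comp CoprodI.of)
    (zpowersHom _ (SemidirectProduct.inl (CoprodI.of (h i)⁻¹) *
      SemidirectProduct.inr (Multiplicative.ofAdd 1))) fun g k => by
    rw [zpowersHom_apply]
    refine Commute.zpow_right ?_ _
    ext
    · simp [mul_assoc, map_mul]
    · simp

/-- The homomorphism from the amalgam to the semidirect product `(H₁ ∗ H₂) ⋊ ℤ`. -/
def Amalg.toTwisted {H : Bool → Type*} [∀ i, Group (H i)] (h : ∀ i, H i) :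
    Amalg H h →* TwistedProduct h :=
  PushoutI.lift (twistedFactor h) SemidirectProduct.inr fun i => by
    ext <;> simp [twistedFactor, amalgMap, amalgU]

/-- The homomorphism from the semidirect product `(H₁ ∗ H₂) ⋊ ℤ` to the amalgam. -/
def Amalg.ofTwisted {H : Bool → Type*} [∀ i, Group (H i)] (h : ∀ i, H i) :
    TwistedProduct h →* Amalg H h :=
  SemidirectProduct.lift
    (CoprodI.lift fun i => (PushoutI.of i).comp (MonoidHom.inl (H i) (Multiplicative ℤ)))
    (PushoutI.base (amalgMap h)) fun k => by
    ext i g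
    have hk : PushoutI.base (amalgMap h) k = PushoutI.of i (amalgMap h i k) :=
      (PushoutI.of_apply_eq_base (amalgMap h) i k).symm
    simp only [MonoidHom.comp_apply, MulEquiv.coe_toMonoidHom, zpowersHom_apply,
      CoprodI.conjFactors_zpow_of, CoprodI.lift_of, MulAut.conj_apply, hk, ← map_mul, ← map_inv]
    congr 1
    ext <;> simp [amalgMap, amalgU]

theorem Amalg.toTwisted_injective {H : Bool → Type*} [∀ i, Group (H i)] (h : ∀ i, H i) :
    Function.Injective (Amalg.toTwisted h) := by
  suffices (Amalg.ofTwisted h).comp (Amalg.toTwisted h) = MonoidHom.id _ from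
    Function.LeftInverse.injective (g := Amalg.ofTwisted h) (DFunLike.congr_fun this)
  have hu : ∀ i, (PushoutI.of i (h i, 1) : Amalg H h)⁻¹ *
      PushoutI.base (amalgMap h) (Multiplicative.ofAdd 1) =
        PushoutI.of i (1, Multiplicative.ofAdd 1) := fun i => by
    rw [← PushoutI.of_apply_eq_base (amalgMap h) i, ← map_inv, ← map_mul]
    congr 1
    ext <;> simp [amalgMap, amalgU]
  ext i x
  simp [Amalg.toTwisted, twistedFactor, Amalg.ofTwisted, hu]
  rw [← map_zpow, ← map_mul]
  congr 1
  ext <;> simp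

theorem IsObraztsov.isMulTorsionFree {K : Type*} [Group K] (hK : IsObraztsov K) :
    IsMulTorsionFree K where
  pow_left_injective n hn a b hab := by
    obtain ⟨-, -, hcenter, -, htf, hsub⟩ := hK
    have hab : a ^ n = b ^ n := hab
    have one_of : ∀ g : K, g ^ n = 1 → g = 1 := fun g hg => by
      by_contra hg1
      exact htf g hg1 (isOfFinOrder_iff_pow_eq_one.2 ⟨n, Nat.pos_of_ne_zero hn, hg⟩)
    have haS : a ∈ Subgroup.closure {a, b} := Subgroup.subset_closure (by simp)
    have hbS : b ∈ Subgroup.closure {a, b} := Subgroup.subset_closure (by simp)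
    have comm : Commute a b → a = b := fun h => by
      rw [← mul_inv_eq_one]
      refine one_of _ ?_
      rw [(h.inv_right).mul_pow, inv_pow, hab, mul_inv_cancel]
    by_cases htop : Subgroup.closure {a, b} = ⊤
    · have hc : a ^ n ∈ Subgroup.center K := by
        rw [← Subgroup.centralizer_univ, ← Subgroup.coe_top, ← htop, Subgroup.centralizer_closure]
        rw [Subgroup.mem_centralizer_iff]
        rintro g (rfl | rfl)
        · exact ((Commute.refl g).pow_right n)
        · rw [hab]
          exact ((Commute.refl g).pow_right n)
      rw [hcenter, Subgroup.mem_bot] at hc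
      rw [one_of a hc, one_of b (hab ▸ hc)]
    · by_cases hbot : Subgroup.closure {a, b} = ⊥
      · rw [hbot, Subgroup.mem_bot] at haS hbS
        rw [haS, hbS]
      · obtain ⟨hcyc, -⟩ := hsub _ hbot htop
        obtain ⟨g, hg⟩ := hcyc.exists_generator
        obtain ⟨p, hp⟩ := hg ⟨a, haS⟩
        obtain ⟨q, hq⟩ := hg ⟨b, hbS⟩
        have hp' : (g : K) ^ p = a := congrArg Subtype.val hp
        have hq' : (g : K) ^ q = b := congrArg Subtype.val hq
        have hpq := (Commute.refl (g : K)).zpow_zpow p q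
        rw [hp', hq'] at hpq
        exact comm hpq

/-- The amalgam `G` of two Obraztsov groups crossed with `ℤ`, amalgamated along `u₁ = u₂`,
has the unique root property; in particular it is torsion-free. -/
theorem stmt_17 (H : Bool → Type*) [∀ i, Group (H i)]
    (hObr : ∀ i, IsObraztsov (H i))
    (h : ∀ i, H i) (hmax : ∀ i, IsMaxCyclicGen (h i)) :
    (∀ (x y : Amalg H h) (n : ℕ), 0 < n → x ^ n = y ^ n → x = y) ∧
    (∀ g : Amalg H h, g ≠ 1 → ¬IsOfFinOrder g) := by
  have := fun i => (hObr i).isMulTorsionFree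
  have := TwistedProduct.isMulTorsionFree h
  have key : ∀ (x y : Amalg H h) (n : ℕ), 0 < n → x ^ n = y ^ n → x = y := fun x y n hn hxy =>
    Amalg.toTwisted_injective h (pow_left_injective hn.ne'
      (by simpa only [map_pow] using congrArg (Amalg.toTwisted h) hxy))
  refine ⟨key, fun g hg hfin => hg ?_⟩
  obtain ⟨n, hn, hgn⟩ := isOfFinOrder_iff_pow_eq_one.1 hfin
  exact key g 1 n hn (by rw [hgn, one_pow])
end
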